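/- Let X be a GC_5 set of 21 nodes with no maximal line, and let A0 ∈ X be a node with m-d sequence (5,5,5,3,2) realized by the ordered used lines (ℓ1,ℓ2,ℓ3,ℓ4,ℓ5); set 𝒜 := X ∩ (ℓ1 ∪ ℓ2 ∪ ℓ3) (#𝒜 = 15) and ℬ := X \ 𝒜 (#ℬ = 6). Then: (i) any line containing at most two nodes of 𝒜 is used by at most one node of 𝒜 (and a line containing at most one node of 𝒜 is used by no node of 𝒜); (ii) in particular, every maximal line of the GC_2 set ℬ (i.e., every line containing three nodes of ℬ) is used by at most one node of 𝒜. -/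

import Mathlib

open MvPolynomial

/-- Evaluation of a bivariate polynomial at a point of the real plane. -/
noncomputable def ev (p : MvPolynomial (Fin 2) ℝ) (A : ℝ × ℝ) : ℝ :=
  MvPolynomial.eval ![A.1, A.2] p

/-- A polynomial of total degree exactly 1, defining a line. -/
def IsLinePoly (l : MvPolynomial (Fin 2) ℝ) : Prop := l.totalDegree = 1

/-- The line (zero set) defined by a polynomial. -/
def lineSet (l : MvPolynomial (Fin 2) ℝ) : Set (ℝ × ℝ) := {A | ev l A = 0}

/-- The number of nodes of `X` lying on the line defined by `l`. -/
noncomputable def nodesOn (X : Set (ℝ × ℝ)) (l : MvPolynomial (Fin 2) ℝ) : ℕ :=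
  (X ∩ lineSet l).ncard

/-- `X` is an `n`-poised set: it has `N = (n+2)(n+1)/2` nodes and the only polynomial of
degree ≤ n vanishing on all of `X` is the zero polynomial. -/
def Poised (n : ℕ) (X : Set (ℝ × ℝ)) : Prop :=
  X.Finite ∧ X.ncard = (n + 2) * (n + 1) / 2 ∧
    ∀ p : MvPolynomial (Fin 2) ℝ, p.totalDegree ≤ n → (∀ A ∈ X, ev p A = 0) → p = 0

/-- `p` is an `n`-fundamental polynomial of the node `A` with respect to `X`. -/
def IsFund (n : ℕ) (X : Set (ℝ × ℝ)) (A : ℝ × ℝ) (p : MvPolynomial (Fin 2) ℝ) : Prop :=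
  p.totalDegree ≤ n ∧ ev p A = 1 ∧ ∀ B ∈ X, B ≠ A → ev p B = 0

/-- `X` is a `GC_n` set: it is `n`-poised and each fundamental polynomial is a product of
`n` linear (degree-1) polynomials. -/
def GCSet (n : ℕ) (X : Set (ℝ × ℝ)) : Prop :=
  Poised n X ∧ ∀ A ∈ X, ∃ p : MvPolynomial (Fin 2) ℝ, IsFund n X A p ∧
    ∃ f : Fin n → MvPolynomial (Fin 2) ℝ, (∀ i, IsLinePoly (f i)) ∧ p = ∏ i, f i

/-- The node `A` uses the line `l`: the linear polynomial `l` divides a fundamental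
polynomial of `A`. -/
def Uses (n : ℕ) (X : Set (ℝ × ℝ)) (A : ℝ × ℝ) (l : MvPolynomial (Fin 2) ℝ) : Prop :=
  ∃ p, IsFund n X A p ∧ l ∣ p

/-- `X` has no maximal line, i.e. no line passes through `n+1` nodes of `X`. -/
def NoMaximalLine (n : ℕ) (X : Set (ℝ × ℝ)) : Prop :=
  ∀ l : MvPolynomial (Fin 2) ℝ, IsLinePoly l → nodesOn X l ≠ n + 1

/-- Number of nodes of `X` on the line `l` which do not lie on any of the lines
`L 0, …, L (s-1)` (the primary node count of `l` at step `s`). -/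
noncomputable def resCount (X : Set (ℝ × ℝ)) (L : Fin 5 → MvPolynomial (Fin 2) ℝ)
    (s : Fin 5) (l : MvPolynomial (Fin 2) ℝ) : ℕ :=
  {B ∈ X | ev l B = 0 ∧ ∀ i : Fin 5, i < s → ev (L i) B ≠ 0}.ncard

/-- `L` is an m-line sequence of the node `A` of the `GC_5` set `X`: it enumerates the five
distinct used lines of `A` (a fundamental polynomial of `A` is, up to a constant, the
product of the `L i`), ordered greedily: at each step `s` the line `L s` has maximal
primary node count among the remaining used lines. -/
def MLineSeq (X : Set (ℝ × ℝ)) (A : ℝ × ℝ) (L : Fin 5 → MvPolynomial (Fin 2) ℝ) : Prop :=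
  (∀ i, IsLinePoly (L i)) ∧
  (∀ i j : Fin 5, i ≠ j → lineSet (L i) ≠ lineSet (L j)) ∧
  (∃ p : MvPolynomial (Fin 2) ℝ, IsFund 5 X A p ∧ ∃ c : ℝ, p = MvPolynomial.C c * ∏ i, L i) ∧
  (∀ s t : Fin 5, s ≤ t → resCount X L s (L t) ≤ resCount X L s (L s))

/-- The node `A` has m-distribution sequence `k`. -/
def HasMDSeq (X : Set (ℝ × ℝ)) (A : ℝ × ℝ) (k : Fin 5 → ℕ) : Prop :=
  ∃ L : Fin 5 → MvPolynomial (Fin 2) ℝ, MLineSeq X A L ∧ ∀ s, resCount X L s (L s) = k s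

lemma ev_mul (p q : MvPolynomial (Fin 2) ℝ) (A : ℝ × ℝ) : ev (p * q) A = ev p A * ev q A :=
  map_mul _ _ _

lemma ev_add (p q : MvPolynomial (Fin 2) ℝ) (A : ℝ × ℝ) : ev (p + q) A = ev p A + ev q A :=
  map_add _ _ _

lemma ev_C (a : ℝ) (A : ℝ × ℝ) : ev (C a) A = a := eval_C a

lemma IsLinePoly.ne_zero {l : MvPolynomial (Fin 2) ℝ} (hl : IsLinePoly l) : l ≠ 0 := by
  rintro rfl
  simp [IsLinePoly] at hl

lemma IsLinePoly.exists_eq {l : MvPolynomial (Fin 2) ℝ} (hl : IsLinePoly l) :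
    ∃ a b c : ℝ, 0 < a ^ 2 + b ^ 2 ∧ l = C a * X 0 + C b * X 1 + C c := by
  have key : l = C (coeff (Finsupp.single 0 1) l) * X 0
      + C (coeff (Finsupp.single 1 1) l) * X 1 + C (coeff 0 l) := by
    ext m
    by_cases hm : 2 ≤ m 0 + m 1
    · rw [coeff_eq_zero_of_totalDegree_lt, eq_comm]
      · have h0 : m ≠ Finsupp.single 0 1 := by rintro rfl; simp at hm
        have h1 : m ≠ Finsupp.single 1 1 := by rintro rfl; simp at hm
        have h2 : m ≠ 0 := by rintro rfl; simp at hm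
        simp [coeff_X, coeff_C, h0.symm, h1.symm, h2.symm]
      · have : m.degree = m 0 + m 1 := by
          rw [Finsupp.degree_eq_sum, Fin.sum_univ_two]
        rw [hl]
        change 1 < m.degree
        omega
    · have h : m = Finsupp.single 0 1 ∨ m = Finsupp.single 1 1 ∨ m = 0 := by
        simp only [Finsupp.ext_iff, Fin.forall_fin_two, Finsupp.single_apply]
        simp
        omega
      have h10 : Finsupp.single (1 : Fin 2) 1 ≠ Finsupp.single (0 : Fin 2) 1 := by
        simp [Finsupp.ext_iff, Fin.forall_fin_two, Finsupp.single_apply]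
      rcases h with rfl | rfl | rfl <;>
        simp [coeff_X, coeff_C, Finsupp.single_eq_zero, eq_comm, h10.symm]
  refine ⟨_, _, _, ?_, key⟩
  by_contra! h
  have ha : coeff (Finsupp.single 0 1) l = 0 := by nlinarith
  have hb : coeff (Finsupp.single 1 1) l = 0 := by nlinarith
  rw [ha, hb] at key
  rw [IsLinePoly, key] at hl
  simp at hl

/-- A polynomial of degree at most `n` vanishing at more than `n` points of a line is divisible
by the polynomial of the line. -/
lemma IsLinePoly.dvd_of_vanish {l p : MvPolynomial (Fin 2) ℝ} (hl : IsLinePoly l) {n : ℕ}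
    (hp : p.totalDegree ≤ n) {S : Set (ℝ × ℝ)} (hS : n < S.ncard)
    (hSl : ∀ B ∈ S, ev l B = 0) (hSp : ∀ B ∈ S, ev p B = 0) : l ∣ p := by
  obtain ⟨a, b, c, hab, rfl⟩ := hl.exists_eq
  set N := a ^ 2 + b ^ 2 with hN
  let f : Fin 2 → Polynomial ℝ :=
    ![Polynomial.C (-b) * Polynomial.X + Polynomial.C (-c * a / N),
      Polynomial.C a * Polynomial.X + Polynomial.C (-c * b / N)]
  let w : MvPolynomial (Fin 2) ℝ := C (-b / N) * X 0 + C (a / N) * X 1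
  let t : ℝ × ℝ → ℝ := fun B => -b / N * B.1 + a / N * B.2
  have hfdeg : (aeval f p).natDegree ≤ n := by
    have := aeval_natDegree_le (n := 1) p hp f (by
      rw [Fin.forall_fin_two]
      exact ⟨Polynomial.natDegree_linear_le, Polynomial.natDegree_linear_le⟩)
    simpa using this
  have hpar : ∀ B ∈ S, -b * t B + -c * a / N = B.1 ∧ a * t B + -c * b / N = B.2 := by
    intro B hB
    have h := hSl B hB
    simp only [ev, map_add, map_mul, eval_C, eval_X, Matrix.cons_val_zero, Matrix.cons_val_one] at h
    have hc : c = -(a * B.1 + b * B.2) := by linarith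
    constructor
    · simp only [t]; field_simp; rw [hc, hN]; ring
    · simp only [t]; field_simp; rw [hc, hN]; ring
  have hev : ∀ B ∈ S, (aeval f p).eval (t B) = 0 := by
    intro B hB
    have h : (Polynomial.aeval (R := ℝ) (t B)).comp (aeval f) = aeval ![B.1, B.2] := by
      apply algHom_ext
      rw [Fin.forall_fin_two]
      simpa [f] using hpar B hB
    have h' := DFunLike.congr_fun h p
    rw [AlgHom.comp_apply, Polynomial.coe_aeval_eq_eval] at h'
    rw [h', ← hSp B hB]
    simp [ev, aeval_eq_eval]
  have hinj : Set.InjOn t S := by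
    intro B hB D hD h
    have h1 := hpar B hB
    have h2 := hpar D hD
    rw [h] at h1
    exact Prod.ext (h1.1.symm.trans h2.1) (h1.2.symm.trans h2.2)
  have hSfin : S.Finite := Set.finite_of_ncard_pos (by omega)
  have hzero : aeval f p = 0 := by
    apply Polynomial.eq_zero_of_natDegree_lt_card_of_eval_eq_zero' _ (hSfin.image t).toFinset
    · intro x hx
      obtain ⟨B, hB, rfl⟩ := (Set.Finite.mem_toFinset _).1 hx
      exact hev B hB
    · rw [← Set.ncard_eq_toFinset_card _ (hSfin.image t), hinj.ncard_image]
      omega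
  set I : Ideal (MvPolynomial (Fin 2) ℝ) := Ideal.span {C a * X 0 + C b * X 1 + C c} with hI
  have hcomp : (Ideal.Quotient.mkₐ ℝ I).comp ((Polynomial.aeval w).comp (aeval f))
      = Ideal.Quotient.mkₐ ℝ I := by
    have hNC : (C a ^ 2 + C b ^ 2) * C (N⁻¹) = (1 : MvPolynomial (Fin 2) ℝ) := by
      rw [← C_pow, ← C_pow, ← C_add, ← C_mul, ← hN, mul_inv_cancel₀ hab.ne', C_1]
    apply algHom_ext
    rw [Fin.forall_fin_two]
    simp only [AlgHom.comp_apply, aeval_X, Ideal.Quotient.mkₐ_eq_mk, Ideal.Quotient.eq, hI,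
      Ideal.mem_span_singleton]
    constructor
    · refine ⟨-C (a / N), ?_⟩
      simp [f, w, div_eq_mul_inv, algebraMap_eq]
      linear_combination X 0 * hNC
    · refine ⟨-C (b / N), ?_⟩
      simp [f, w, div_eq_mul_inv, algebraMap_eq]
      linear_combination X 1 * hNC
  have h := DFunLike.congr_fun hcomp p
  rw [AlgHom.comp_apply, AlgHom.comp_apply, hzero, map_zero, map_zero, eq_comm,
    Ideal.Quotient.mkₐ_eq_mk, Ideal.Quotient.eq_zero_iff_mem, hI, Ideal.mem_span_singleton] at h
  exact h

lemma IsLinePoly.totalDegree_le_of_mul {l r : MvPolynomial (Fin 2) ℝ} (hl : IsLinePoly l) {n : ℕ}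
    (h : (l * r).totalDegree ≤ n + 1) : r.totalDegree ≤ n := by
  rcases eq_or_ne r 0 with rfl | hr
  · simp
  · rw [totalDegree_mul_of_isDomain hl.ne_zero hr, hl] at h
    omega

/-- Splitting a line off a polynomial of degree at most `n + 1`. -/
lemma IsLinePoly.exists_eq_mul_of_vanish {l p : MvPolynomial (Fin 2) ℝ} (hl : IsLinePoly l) {n : ℕ}
    (hp : p.totalDegree ≤ n + 1) {S : Set (ℝ × ℝ)} (hS : n + 1 < S.ncard)
    (hSl : ∀ B ∈ S, ev l B = 0) (hSp : ∀ B ∈ S, ev p B = 0) :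
    ∃ r, p = l * r ∧ r.totalDegree ≤ n := by
  obtain ⟨r, rfl⟩ := hl.dvd_of_vanish hp hS hSl hSp
  exact ⟨r, rfl, hl.totalDegree_le_of_mul hp⟩

/-- A polynomial of degree at most 4 vanishing at 5, 4, 3 points of three lines, no point lying
on two of them, vanishes on these lines. -/
lemma vanish_of_vanish_five_four_three {l₀ l₁ l₂ q : MvPolynomial (Fin 2) ℝ}
    (h₀ : IsLinePoly l₀) (h₁ : IsLinePoly l₁) (h₂ : IsLinePoly l₂) (hq : q.totalDegree ≤ 4)
    {S₀ S₁ S₂ : Set (ℝ × ℝ)} (c₀ : 5 ≤ S₀.ncard) (c₁ : 4 ≤ S₁.ncard) (c₂ : 3 ≤ S₂.ncard)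
    (z₀ : ∀ B ∈ S₀, ev l₀ B = 0 ∧ ev q B = 0)
    (z₁ : ∀ B ∈ S₁, ev l₁ B = 0 ∧ ev q B = 0 ∧ ev l₀ B ≠ 0)
    (z₂ : ∀ B ∈ S₂, ev l₂ B = 0 ∧ ev q B = 0 ∧ ev l₀ B ≠ 0 ∧ ev l₁ B ≠ 0)
    (B : ℝ × ℝ) (hB : ev l₀ B = 0 ∨ ev l₁ B = 0 ∨ ev l₂ B = 0) : ev q B = 0 := by
  obtain ⟨r, rfl, hr⟩ := h₀.exists_eq_mul_of_vanish hq (by omega)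
    (fun B hB => (z₀ B hB).1) (fun B hB => (z₀ B hB).2)
  simp only [ev_mul, mul_eq_zero] at z₁ z₂ ⊢
  obtain ⟨r, rfl, hr'⟩ := h₁.exists_eq_mul_of_vanish hr (by omega)
    (fun B hB => (z₁ B hB).1) (fun B hB => (z₁ B hB).2.1.resolve_left (z₁ B hB).2.2)
  simp only [ev_mul, mul_eq_zero] at z₂ ⊢
  obtain ⟨r, rfl, -⟩ := h₂.exists_eq_mul_of_vanish hr' (by omega)
    (fun B hB => (z₂ B hB).1)
    (fun B hB => ((z₂ B hB).2.1.resolve_left (z₂ B hB).2.2.1).resolve_left (z₂ B hB).2.2.2)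
  simp only [ev_mul, mul_eq_zero]
  tauto

lemma IsFund.ncard_inter_le {X : Set (ℝ × ℝ)} {n : ℕ} {A : ℝ × ℝ}
    {p l : MvPolynomial (Fin 2) ℝ} (hp : IsFund n X A p) (hl : IsLinePoly l) (hA : ev l A = 0) :
    (X ∩ lineSet l).ncard ≤ n + 1 := by
  by_contra! h
  have hd : l ∣ p := hl.dvd_of_vanish hp.1 (S := (X ∩ lineSet l) \ {A})
    (by have := Set.pred_ncard_le_ncard_sdiff_singleton (X ∩ lineSet l) A; omega)
    (fun B hB => hB.1.2) (fun B hB => hp.2.2 B hB.1.1 hB.2)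
  obtain ⟨r, rfl⟩ := hd
  have := hp.2.1
  simp [ev_mul, hA] at this

lemma GCSet.ncard_inter_le {X : Set (ℝ × ℝ)} {n : ℕ} (hX : GCSet n X)
    (hnm : NoMaximalLine n X) {l : MvPolynomial (Fin 2) ℝ} (hl : IsLinePoly l) :
    (X ∩ lineSet l).ncard ≤ n := by
  rcases (X ∩ lineSet l).eq_empty_or_nonempty with h | ⟨A, hA, hAl⟩
  · simp [h]
  · obtain ⟨p, hp, -⟩ := hX.2 A hA
    have h1 := hp.ncard_inter_le hl hAl
    have h2 := hnm l hl
    unfold nodesOn at h2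
    omega

lemma Uses.exists_quotient {n : ℕ} {X : Set (ℝ × ℝ)} {A : ℝ × ℝ} {l : MvPolynomial (Fin 2) ℝ}
    (hl : IsLinePoly l) (h : Uses (n + 1) X A l) :
    ∃ q : MvPolynomial (Fin 2) ℝ, q.totalDegree ≤ n ∧ ev l A ≠ 0 ∧ ev q A ≠ 0 ∧
      ∀ B ∈ X, B ≠ A → ev l B ≠ 0 → ev q B = 0 := by
  obtain ⟨_, ⟨hdeg, hA, hB⟩, q, rfl⟩ := h
  have hne : ev l A * ev q A ≠ 0 := by rw [← ev_mul, hA]; exact one_ne_zero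
  refine ⟨q, hl.totalDegree_le_of_mul hdeg, left_ne_zero_of_mul hne, right_ne_zero_of_mul hne,
    fun B hBX hBA hBl => ?_⟩
  have := hB B hBX hBA
  rw [ev_mul] at this
  exact (mul_eq_zero.1 this).resolve_left hBl

/-- Three lines with five nodes of `X` each, no node lying on two of them. -/
structure DisjointLines (X : Set (ℝ × ℝ)) (K : Fin 3 → MvPolynomial (Fin 2) ℝ) : Prop where
  isLinePoly : ∀ i, IsLinePoly (K i)
  finite : X.Finite
  card : ∀ i, (X ∩ lineSet (K i)).ncard = 5
  disj : ∀ i j, i ≠ j → ∀ B ∈ X, ev (K i) B = 0 → ev (K j) B ≠ 0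

namespace DisjointLines

variable {X : Set (ℝ × ℝ)} {K : Fin 3 → MvPolynomial (Fin 2) ℝ}

lemma sum_ncard_le (h : DisjointLines X K) {T : Set (ℝ × ℝ)} (hT : T ⊆ X) :
    ∑ i, (T ∩ lineSet (K i)).ncard ≤ T.ncard := by
  have hfin := h.finite.subset hT
  have hd : ∀ i j, i ≠ j → Disjoint (T ∩ lineSet (K i)) (T ∩ lineSet (K j)) := fun i j hij =>
    Set.disjoint_left.2 fun B hB hB' => h.disj i j hij B (hT hB.1) hB.2 hB'.2
  have hf : ∀ i, (T ∩ lineSet (K i)).Finite := fun i => hfin.inter_of_left _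
  rw [Fin.sum_univ_three, ← Set.ncard_union_eq (hd 0 1 (by simp)) (hf 0) (hf 1),
    ← Set.ncard_union_eq (Set.disjoint_union_left.2 ⟨hd 0 2 (by simp), hd 1 2 (by simp)⟩)
      ((hf 0).union (hf 1)) (hf 2)]
  exact Set.ncard_le_ncard (Set.union_subset (Set.union_subset Set.inter_subset_left
    Set.inter_subset_left) Set.inter_subset_left) hfin

/-- A line with at most two nodes on the three lines has at most one on each of them. -/
lemma ncard_inter_le_one (h : DisjointLines X K) {l : MvPolynomial (Fin 2) ℝ}
    (hl : IsLinePoly l) {E : Set (ℝ × ℝ)}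
    (hE : E = X ∩ {B | ∃ i, ev (K i) B = 0} ∩ lineSet l) (hcard : E.ncard ≤ 2) (i : Fin 3) :
    (E ∩ lineSet (K i)).ncard ≤ 1 := by
  subst hE
  by_contra! h2
  obtain ⟨r, hr⟩ := (h.isLinePoly i).dvd_of_vanish hl.le h2 (fun B hB => hB.2)
    (fun B hB => hB.1.2)
  have hsub : X ∩ lineSet (K i) ⊆ X ∩ {B | ∃ i, ev (K i) B = 0} ∩ lineSet l := fun B hB =>
    ⟨⟨hB.1, i, hB.2⟩, by
      change ev l B = 0
      rw [hr, ev_mul, show ev (K i) B = 0 from hB.2, zero_mul]⟩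
  have := Set.ncard_le_ncard hsub ((h.finite.inter_of_left _).inter_of_left _)
  rw [h.card i] at this
  omega

/-- Sorting three numbers: at most 0, at most 1, at most 2. -/
lemma exists_sort_le {m : Fin 3 → ℕ} (h0 : ∃ i, m i = 0) (h2 : ∀ i, m i ≤ 2)
    (hs : ∑ i, m i ≤ 3) :
    ∃ i j k : Fin 3, i ≠ j ∧ i ≠ k ∧ j ≠ k ∧ m i = 0 ∧ m j ≤ 1 ∧ m k ≤ 2 := by
  rw [Fin.sum_univ_three] at hs
  obtain ⟨i, hi⟩ := h0
  fin_cases i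
  · by_cases h : m 1 ≤ 1
    · exact ⟨0, 1, 2, by simp, by simp, by simp, hi, h, h2 2⟩
    · exact ⟨0, 2, 1, by simp, by simp, by simp, hi, by omega, h2 1⟩
  · by_cases h : m 0 ≤ 1
    · exact ⟨1, 0, 2, by simp, by simp, by simp, hi, h, h2 2⟩
    · exact ⟨1, 2, 0, by simp, by simp, by simp, hi, by omega, h2 0⟩
  · by_cases h : m 0 ≤ 1
    · exact ⟨2, 0, 1, by simp, by simp, by simp, hi, h, h2 1⟩
    · exact ⟨2, 1, 0, by simp, by simp, by simp, hi, by omega, h2 0⟩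

/-- A polynomial of degree at most 4 vanishes on the three lines if its nonzeros among the nodes
are few. -/
lemma vanish_of_few_nonzeros (h : DisjointLines X K)
    {q : MvPolynomial (Fin 2) ℝ} (hq : q.totalDegree ≤ 4) {T : Set (ℝ × ℝ)} (hT : T ⊆ X)
    (hqT : ∀ B ∈ X, (∃ i, ev (K i) B = 0) → B ∉ T → ev q B = 0) (h3 : T.ncard ≤ 3)
    (h0 : ∃ i, (T ∩ lineSet (K i)).ncard = 0) (h2 : ∀ i, (T ∩ lineSet (K i)).ncard ≤ 2)
    {m : Fin 3} {B : ℝ × ℝ} (hB : ev (K m) B = 0) : ev q B = 0 := by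
  obtain ⟨i, j, k, hij, hik, hjk, hi, hj, hk⟩ :=
    exists_sort_le h0 h2 ((h.sum_ncard_le hT).trans h3)
  have hS : ∀ i, 5 ≤ ((X ∩ lineSet (K i)) \ T).ncard + (T ∩ lineSet (K i)).ncard := by
    intro i
    rw [← h.card i]
    have hle : (X ∩ lineSet (K i)) \ (T ∩ lineSet (K i)) = (X ∩ lineSet (K i)) \ T := by
      ext; simp; tauto
    rw [← hle, add_comm, ← tsub_le_iff_left]
    exact Set.le_ncard_sdiff _ _ ((h.finite.subset hT).inter_of_left _)
  have z : ∀ i, ∀ B ∈ (X ∩ lineSet (K i)) \ T, ev (K i) B = 0 ∧ ev q B = 0 :=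
    fun i B hB => ⟨hB.1.2, hqT B hB.1.1 ⟨i, hB.1.2⟩ hB.2⟩
  refine vanish_of_vanish_five_four_three (h.isLinePoly i) (h.isLinePoly j) (h.isLinePoly k) hq
    (S₀ := (X ∩ lineSet (K i)) \ T) (S₁ := (X ∩ lineSet (K j)) \ T)
    (S₂ := (X ∩ lineSet (K k)) \ T)
    (by have := hS i; omega) (by have := hS j; omega) (by have := hS k; omega)
    (z i) (fun B hB => ⟨(z j B hB).1, (z j B hB).2, h.disj j i hij.symm B hB.1.1 hB.1.2⟩)
    (fun B hB => ⟨(z k B hB).1, (z k B hB).2, h.disj k i hik.symm B hB.1.1 hB.1.2,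
      h.disj k j hjk.symm B hB.1.1 hB.1.2⟩) B ?_
  have : m = i ∨ m = j ∨ m = k := by omega
  rcases this with rfl | rfl | rfl <;> tauto

/-- A line with at most one node on the three lines is used by none of these nodes. -/
lemma not_uses (h : DisjointLines X K) {l : MvPolynomial (Fin 2) ℝ} (hl : IsLinePoly l)
    (hcard : (X ∩ {B | ∃ i, ev (K i) B = 0} ∩ lineSet l).ncard ≤ 1) {A : ℝ × ℝ} (hA : A ∈ X)
    (hAK : ∃ i, ev (K i) A = 0) : ¬ Uses 5 X A l := by
  intro hu
  obtain ⟨q, hq, -, hqA, hqB⟩ := hu.exists_quotient hl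
  set E := X ∩ {B | ∃ i, ev (K i) B = 0} ∩ lineSet l with hE
  obtain ⟨m, hm⟩ := hAK
  have hEX : E ⊆ X := fun B hB => hB.1.1
  have hT : insert A E ⊆ X := Set.insert_subset hA hEX
  have hT2 : (insert A E).ncard ≤ 2 := (Set.ncard_insert_le A E).trans (by omega)
  have hsum := (h.sum_ncard_le hT).trans hT2
  rw [Fin.sum_univ_three] at hsum
  refine hqA (h.vanish_of_few_nonzeros hq hT ?_ (by omega) ?_ ?_ hm)
  · intro B hB hBK hBT
    rw [Set.mem_insert_iff, not_or] at hBT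
    exact hqB B hB hBT.1 fun hl0 => hBT.2 ⟨⟨hB, hBK⟩, hl0⟩
  · by_contra! hne
    have := hne 0
    have := hne 1
    have := hne 2
    omega
  · rw [Fin.forall_fin_succ, Fin.forall_fin_two]
    exact ⟨by omega, by change Set.ncard (_ ∩ lineSet (K 1)) ≤ 2; omega,
      by change Set.ncard (_ ∩ lineSet (K 2)) ≤ 2; omega⟩

/-- Among at most four points, at most three of them on each line, one can be removed so that
one line becomes empty and each line keeps at most two. -/
lemma exists_removal (h : DisjointLines X K) {T : Set (ℝ × ℝ)} (hT : T ⊆ X) (h4 : T.ncard ≤ 4)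
    (hne : T.Nonempty) (h3 : ∀ i, (T ∩ lineSet (K i)).ncard ≤ 3) :
    ∃ P ∈ T, (∃ i, ((T \ {P}) ∩ lineSet (K i)).ncard = 0) ∧
      ∀ i, ((T \ {P}) ∩ lineSet (K i)).ncard ≤ 2 := by
  have hsum := (h.sum_ncard_le hT).trans h4
  rw [Fin.sum_univ_three] at hsum
  have hle : ∀ P i, ((T \ {P}) ∩ lineSet (K i)).ncard ≤ (T ∩ lineSet (K i)).ncard := fun P i =>
    Set.ncard_le_ncard (Set.inter_subset_inter_left _ Set.sdiff_subset)
      ((h.finite.subset hT).inter_of_left _)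
  have hlt : ∀ i, (T ∩ lineSet (K i)).ncard ≠ 0 → ∃ P ∈ T,
      ((T \ {P}) ∩ lineSet (K i)).ncard + 1 = (T ∩ lineSet (K i)).ncard := by
    intro i hi
    obtain ⟨P, hP⟩ := Set.nonempty_of_ncard_ne_zero hi
    refine ⟨P, hP.1, ?_⟩
    rw [← Set.inter_sdiff_right_comm]
    exact Set.ncard_sdiff_singleton_add_one hP ((h.finite.subset hT).inter_of_left _)
  have hthree : ∀ i : Fin 3, i = 0 ∨ i = 1 ∨ i = 2 := by omega
  by_cases c3 : ∃ i, (T ∩ lineSet (K i)).ncard = 3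
  · obtain ⟨i, hi⟩ := c3
    obtain ⟨P, hP, hPi⟩ := hlt i (by omega)
    have l0 := hle P 0
    have l1 := hle P 1
    have l2 := hle P 2
    refine ⟨P, hP, ?_, fun j => ?_⟩
    · by_contra! hn
      have := hn 0
      have := hn 1
      have := hn 2
      rcases hthree i with rfl | rfl | rfl <;> omega
    · rcases hthree i with rfl | rfl | rfl <;> rcases hthree j with rfl | rfl | rfl <;> omega
  · push Not at c3
    have h2 : ∀ i, (T ∩ lineSet (K i)).ncard ≤ 2 := fun i => by
      have := h3 i
      have := c3 i
      omega
    by_cases c1 : ∃ i, (T ∩ lineSet (K i)).ncard = 1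
    · obtain ⟨i, hi⟩ := c1
      obtain ⟨P, hP, hPi⟩ := hlt i (by omega)
      exact ⟨P, hP, ⟨i, by omega⟩, fun j => (hle P j).trans (h2 j)⟩
    · push Not at c1
      obtain ⟨P, hP⟩ := hne
      refine ⟨P, hP, ?_, fun j => (hle P j).trans (h2 j)⟩
      by_contra! hn
      have := hn 0
      have := hn 1
      have := hn 2
      have := hle P 0
      have := hle P 1
      have := hle P 2
      have := c1 0
      have := c1 1
      have := c1 2
      omega

/-- A line with at most two nodes on the three lines is used by at most one of these nodes. -/
lemma eq_of_uses (h : DisjointLines X K) {l : MvPolynomial (Fin 2) ℝ} (hl : IsLinePoly l)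
    (hcard : (X ∩ {B | ∃ i, ev (K i) B = 0} ∩ lineSet l).ncard ≤ 2) {A₁ A₂ : ℝ × ℝ}
    (hA₁ : A₁ ∈ X) (hA₂ : A₂ ∈ X) (hK₁ : ∃ i, ev (K i) A₁ = 0) (hK₂ : ∃ i, ev (K i) A₂ = 0)
    (hu₁ : Uses 5 X A₁ l) (hu₂ : Uses 5 X A₂ l) : A₁ = A₂ := by
  by_contra hne
  obtain ⟨q₁, hd₁, hl₁, hq₁, hz₁⟩ := hu₁.exists_quotient hl
  obtain ⟨q₂, hd₂, hl₂, hq₂, hz₂⟩ := hu₂.exists_quotient hl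
  set E := X ∩ {B | ∃ i, ev (K i) B = 0} ∩ lineSet l with hE
  have hEX : E ⊆ X := fun B hB => hB.1.1
  have hT : {A₁, A₂} ∪ E ⊆ X := by
    rintro B ((rfl | rfl) | hB)
    exacts [hA₁, hA₂, hEX hB]
  have hpair : ({A₁, A₂} : Set (ℝ × ℝ)).ncard = 2 := Set.ncard_pair hne
  have h4 : ({A₁, A₂} ∪ E).ncard ≤ 4 := (Set.ncard_union_le _ _).trans (by omega)
  have h3 : ∀ i, (({A₁, A₂} ∪ E) ∩ lineSet (K i)).ncard ≤ 3 := by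
    intro i
    have h1 := h.ncard_inter_le_one hl hE hcard i
    rw [Set.union_inter_distrib_right]
    have h2 : ({A₁, A₂} ∩ lineSet (K i)).ncard ≤ ({A₁, A₂} : Set (ℝ × ℝ)).ncard :=
      Set.ncard_le_ncard Set.inter_subset_left (Set.toFinite _)
    exact (Set.ncard_union_le _ _).trans (by omega)
  obtain ⟨P, hP, h0, h2⟩ := h.exists_removal hT h4 ⟨A₁, by simp⟩ h3
  obtain ⟨a, b, hab, hPab⟩ : ∃ a b : ℝ, (a ≠ 0 ∨ b ≠ 0) ∧ a * ev q₁ P + b * ev q₂ P = 0 := by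
    by_cases hz : ev q₁ P = 0
    · exact ⟨1, 0, by simp, by simp [hz]⟩
    · exact ⟨ev q₂ P, -ev q₁ P, by simp [hz], by ring⟩
  have hev : ∀ B, ev (C a * q₁ + C b * q₂) B = a * ev q₁ B + b * ev q₂ B := fun B => by
    rw [ev_add, ev_mul, ev_mul, ev_C, ev_C]
  have hdeg : (C a * q₁ + C b * q₂).totalDegree ≤ 4 := by
    refine (totalDegree_add _ _).trans (max_le ?_ ?_) <;>
    · refine (totalDegree_mul _ _).trans ?_
      rwa [totalDegree_C, zero_add]
  have hvan : ∀ m B, ev (K m) B = 0 → a * ev q₁ B + b * ev q₂ B = 0 := by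
    intro m B hB
    rw [← hev]
    refine h.vanish_of_few_nonzeros hdeg (Set.sdiff_subset.trans hT) ?_ ?_ h0 h2 hB
    · intro D hD hDK hDT
      rw [hev]
      by_cases hDP : D = P
      · rw [hDP, hPab]
      · have hDT' : D ∉ {A₁, A₂} ∪ E := fun hmem => hDT ⟨hmem, hDP⟩
        simp only [Set.mem_union, Set.mem_insert_iff, Set.mem_singleton_iff, not_or] at hDT'
        have hlD : ev l D ≠ 0 := fun hl0 => hDT'.2 ⟨⟨hD, hDK⟩, hl0⟩
        rw [hz₁ D hD hDT'.1.1 hlD, hz₂ D hD hDT'.1.2 hlD, mul_zero, mul_zero, add_zero]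
    · have := Set.ncard_sdiff_singleton_add_one hP (h.finite.subset hT)
      omega
  obtain ⟨m₁, hm₁⟩ := hK₁
  obtain ⟨m₂, hm₂⟩ := hK₂
  have e₁ := hvan m₁ A₁ hm₁
  have e₂ := hvan m₂ A₂ hm₂
  rw [hz₂ A₁ hA₁ hne hl₁, mul_zero, add_zero] at e₁
  rw [hz₁ A₂ hA₂ (Ne.symm hne) hl₂, mul_zero, zero_add] at e₂
  rcases hab with ha | hb
  · exact mul_ne_zero ha hq₁ e₁
  · exact mul_ne_zero hb hq₂ e₂

end DisjointLines

lemma GCSet.disjointLines {X : Set (ℝ × ℝ)} (hX : GCSet 5 X) (hnm : NoMaximalLine 5 X)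
    {L : Fin 5 → MvPolynomial (Fin 2) ℝ} (hL : ∀ i, IsLinePoly (L i))
    (hk : ∀ s : Fin 5, s ≤ 2 → resCount X L s (L s) = 5) :
    DisjointLines X ![L 0, L 1, L 2] := by
  have key : ∀ s : Fin 5, s ≤ 2 →
      {B ∈ X | ev (L s) B = 0 ∧ ∀ i : Fin 5, i < s → ev (L i) B ≠ 0} = X ∩ lineSet (L s) := by
    intro s hs
    refine Set.eq_of_subset_of_ncard_le (fun B hB => ⟨hB.1, hB.2.1⟩) ?_
      (hX.1.1.inter_of_left _)
    exact (hX.ncard_inter_le hnm (hL s)).trans (hk s hs).ge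
  have hlt : ∀ i s : Fin 5, i < s → s ≤ 2 → ∀ B ∈ X, ev (L s) B = 0 → ev (L i) B ≠ 0 := by
    intro i s his hs B hB hBs
    have hmem : B ∈ X ∩ lineSet (L s) := ⟨hB, hBs⟩
    rw [← key s hs] at hmem
    exact hmem.2.2 i his
  have h01 := hlt 0 1 (by decide) (by decide)
  have h02 := hlt 0 2 (by decide) (by decide)
  have h12 := hlt 1 2 (by decide) (by decide)
  have hc : ∀ s : Fin 5, s ≤ 2 → (X ∩ lineSet (L s)).ncard = 5 := fun s hs => by
    rw [← key s hs]
    exact hk s hs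
  refine ⟨?_, hX.1.1, ?_, ?_⟩
  · intro i
    fin_cases i
    exacts [hL 0, hL 1, hL 2]
  · intro i
    fin_cases i
    exacts [hc 0 (by decide), hc 1 (by decide), hc 2 (by decide)]
  · intro i j hij B hB hi hj
    fin_cases i <;> fin_cases j
    exacts [hij rfl, h01 B hB hj hi, h02 B hB hj hi, h01 B hB hi hj, hij rfl, h12 B hB hj hi,
      h02 B hB hi hj, h12 B hB hi hj, hij rfl]

/-- in the `(5,5,5,3,2)` setup: (i) a line containing at most two nodes of
`𝒜` is used by at most one node of `𝒜`, and a line containing at most one node of `𝒜` is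
used by no node of `𝒜`; (ii) every maximal line of the `GC_2` set `ℬ` (a line containing
three nodes of `ℬ`) is used by at most one node of `𝒜`. -/
theorem few_A_nodes_few_users
    (X : Set (ℝ × ℝ)) (hX : GCSet 5 X) (hnm : NoMaximalLine 5 X)
    (A0 : ℝ × ℝ) (hA0 : A0 ∈ X) (L : Fin 5 → MvPolynomial (Fin 2) ℝ)
    (hL : MLineSeq X A0 L) (hk : ∀ s, resCount X L s (L s) = ![5, 5, 5, 3, 2] s)
    (SA SB : Set (ℝ × ℝ))
    (hSA : SA = X ∩ (lineSet (L 0) ∪ lineSet (L 1) ∪ lineSet (L 2)))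
    (hSB : SB = X \ SA) :
    (∀ l : MvPolynomial (Fin 2) ℝ, IsLinePoly l → (SA ∩ lineSet l).ncard ≤ 2 →
      ∀ A1 ∈ SA, ∀ A2 ∈ SA, Uses 5 X A1 l → Uses 5 X A2 l → A1 = A2) ∧
    (∀ l : MvPolynomial (Fin 2) ℝ, IsLinePoly l → (SA ∩ lineSet l).ncard ≤ 1 →
      ∀ A ∈ SA, ¬ Uses 5 X A l) ∧
    (∀ l : MvPolynomial (Fin 2) ℝ, IsLinePoly l → (SB ∩ lineSet l).ncard = 3 →
      ∀ A1 ∈ SA, ∀ A2 ∈ SA, Uses 5 X A1 l → Uses 5 X A2 l → A1 = A2) := by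
  have h : DisjointLines X ![L 0, L 1, L 2] := by
    refine hX.disjointLines hnm hL.1 fun s hs => ?_
    rw [hk s]
    fin_cases s <;> first | rfl | exact absurd hs (by decide)
  have hSA' : SA = X ∩ {B | ∃ i, ev ((![L 0, L 1, L 2] : Fin 3 → _) i) B = 0} := by
    rw [hSA]
    ext B
    simp [Fin.exists_fin_succ, lineSet, or_assoc]
  have huniq : ∀ l : MvPolynomial (Fin 2) ℝ, IsLinePoly l → (SA ∩ lineSet l).ncard ≤ 2 →
      ∀ A1 ∈ SA, ∀ A2 ∈ SA, Uses 5 X A1 l → Uses 5 X A2 l → A1 = A2 := by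
    intro l hl hcard A1 hA1 A2 hA2 hu1 hu2
    rw [hSA'] at hcard hA1 hA2
    exact h.eq_of_uses hl hcard hA1.1 hA2.1 hA1.2 hA2.2 hu1 hu2
  refine ⟨huniq, ?_, ?_⟩
  · intro l hl hcard A hA
    rw [hSA'] at hcard hA
    exact h.not_uses hl hcard hA.1 hA.2
  · intro l hl hcard
    refine huniq l hl ?_
    have hX5 := hX.ncard_inter_le hnm hl
    have hunion : X ∩ lineSet l = (SA ∩ lineSet l) ∪ (SB ∩ lineSet l) := by
      rw [← Set.union_inter_distrib_right, hSB, Set.union_sdiff_cancel]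
      exact hSA ▸ Set.inter_subset_left
    have hfin : SA.Finite := hSA ▸ hX.1.1.inter_of_left _
    have hdisj : Disjoint (SA ∩ lineSet l) (SB ∩ lineSet l) :=
      (hSB ▸ Set.disjoint_sdiff_right).mono Set.inter_subset_left Set.inter_subset_left
    rw [hunion, Set.ncard_union_eq hdisj (hfin.inter_of_left _)
      (Set.finite_of_ncard_pos (by omega))] at hX5
    omega
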